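/- Let (f_j)_{j=1}^s, (g_k)_{k=1}^t, (h_l)_{l=1}^w be finite families of polynomials in ℝ[X₁,…,Xₙ]. Then the set {z ∈ ℝⁿ | f_j(z) ≥ 0 for all j = 1,…,s; g_k(z) ≠ 0 for all k = 1,…,t; h_l(z) = 0 for all l = 1,…,w} is empty if and only if there exist sum-of-squares polynomials σ_α for each α ∈ {0,1}^s, an exponent vector β ∈ ℕ^t, and polynomials λ_1,…,λ_w ∈ ℝ[X₁,…,Xₙ] such that (Σ_{α∈{0,1}^s} σ_α · ∏_{j=1}^s f_j^{α_j}) + (∏_{k=1}^t g_k^{β_k})² + (Σ_{l=1}^w λ_l · h_l) = 0 as polynomials. -/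

import Mathlib

open MvPolynomial

/-- A polynomial is a sum of squares if it is a finite sum of squares of polynomials. -/
def IsSOS {n : ℕ} (p : MvPolynomial (Fin n) ℝ) : Prop :=
  ∃ (m : ℕ) (q : Fin m → MvPolynomial (Fin n) ℝ), p = ∑ i, (q i) ^ 2

/-- A subset of a commutative ring closed under sums and products and containing all squares. -/
structure IsSquareCone {A : Type*} [CommRing A] (Q : Set A) : Prop where
  add_mem : ∀ {x y}, x ∈ Q → y ∈ Q → x + y ∈ Q
  mul_mem : ∀ {x y}, x ∈ Q → y ∈ Q → x * y ∈ Q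
  sq_mem : ∀ x, x ^ 2 ∈ Q

namespace IsSquareCone

variable {A : Type*} [CommRing A] {Q : Set A}

theorem zero_mem (hQ : IsSquareCone Q) : (0 : A) ∈ Q := by simpa using hQ.sq_mem 0

theorem one_mem (hQ : IsSquareCone Q) : (1 : A) ∈ Q := by simpa using hQ.sq_mem 1

/-- The cone obtained from `Q` by adjoining the element `a`. -/
theorem adjoin (hQ : IsSquareCone Q) (a : A) :
    IsSquareCone {x | ∃ q ∈ Q, ∃ r ∈ Q, x = q + a * r} where
  add_mem := by
    rintro _ _ ⟨q, hq, r, hr, rfl⟩ ⟨q', hq', r', hr', rfl⟩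
    exact ⟨q + q', hQ.add_mem hq hq', r + r', hQ.add_mem hr hr', by ring⟩
  mul_mem := by
    rintro _ _ ⟨q, hq, r, hr, rfl⟩ ⟨q', hq', r', hr', rfl⟩
    refine ⟨q * q' + a ^ 2 * (r * r'), hQ.add_mem (hQ.mul_mem hq hq')
      (hQ.mul_mem (hQ.sq_mem a) (hQ.mul_mem hr hr')), q * r' + q' * r,
      hQ.add_mem (hQ.mul_mem hq hr') (hQ.mul_mem hq' hr), by ring⟩
  sq_mem x := ⟨x ^ 2, hQ.sq_mem x, 0, hQ.zero_mem, by ring⟩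

/-- A cone containing no `-m ^ 2` with `m ∈ M` extends to a prime cone with the same property. -/
theorem exists_prime_extension (hQ : IsSquareCone Q) (M : Submonoid A)
    (hM : ∀ m ∈ M, -m ^ 2 ∉ Q) :
    ∃ P : Set A, IsSquareCone P ∧ Q ⊆ P ∧ (∀ m ∈ M, -m ^ 2 ∉ P) ∧ (∀ a, a ∈ P ∨ -a ∈ P) ∧
      ∀ a b, a * b ∈ P → -(a * b) ∈ P → (a ∈ P ∧ -a ∈ P) ∨ (b ∈ P ∧ -b ∈ P) := by
  obtain ⟨P, hQP, hP⟩ := zorn_subset_nonempty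
    {P : Set A | IsSquareCone P ∧ ∀ m ∈ M, -m ^ 2 ∉ P} (by
      intro c hc hchain ⟨S₀, hS₀⟩
      refine ⟨⋃₀ c, ⟨⟨?_, ?_, fun x ↦ ⟨S₀, hS₀, (hc hS₀).1.sq_mem x⟩⟩, ?_⟩,
        fun s hs ↦ Set.subset_sUnion_of_mem hs⟩
      · rintro x y ⟨S, hS, hx⟩ ⟨S', hS', hy⟩
        rcases hchain.total hS hS' with h | h
        · exact ⟨S', hS', (hc hS').1.add_mem (h hx) hy⟩
        · exact ⟨S, hS, (hc hS).1.add_mem hx (h hy)⟩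
      · rintro x y ⟨S, hS, hx⟩ ⟨S', hS', hy⟩
        rcases hchain.total hS hS' with h | h
        · exact ⟨S', hS', (hc hS').1.mul_mem (h hx) hy⟩
        · exact ⟨S, hS, (hc hS).1.mul_mem hx (h hy)⟩
      · rintro m hm ⟨S, hS, hmS⟩
        exact (hc hS).2 m hm hmS) Q ⟨hQ, hM⟩
  have hPc : IsSquareCone P := hP.prop.1
  have hPM : ∀ m ∈ M, -m ^ 2 ∉ P := hP.prop.2
  have key : ∀ a ∉ P, ∃ m ∈ M, ∃ q ∈ P, ∃ r ∈ P, -m ^ 2 = q + a * r := by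
    intro a ha
    by_contra! hcon
    have hle : P ⊆ {x | ∃ q ∈ P, ∃ r ∈ P, x = q + a * r} :=
      fun x hx ↦ ⟨x, hx, 0, hPc.zero_mem, by ring⟩
    have := hP.le_of_ge (y := {x | ∃ q ∈ P, ∃ r ∈ P, x = q + a * r}) ⟨hPc.adjoin a, by
      rintro m hm ⟨q, hq, r, hr, h⟩
      exact hcon m hm q hq r hr h⟩ hle
    exact ha (this ⟨0, hPc.zero_mem, 1, hPc.one_mem, by ring⟩)
  have htot : ∀ a, a ∈ P ∨ -a ∈ P := by
    intro a
    by_contra! hcon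
    obtain ⟨m, hm, q, hq, r, hr, h⟩ := key a hcon.1
    obtain ⟨m', hm', q', hq', r', hr', h'⟩ := key (-a) hcon.2
    refine hPM (m * m') (M.mul_mem hm hm') ?_
    have : -(m * m') ^ 2 = m ^ 2 * q' + m' ^ 2 * q + q * q' + a ^ 2 * (r * r') := by
      linear_combination (m' ^ 2 + q') * h - a * r * h'
    rw [this]
    exact hPc.add_mem (hPc.add_mem (hPc.add_mem (hPc.mul_mem (hPc.sq_mem _) hq')
      (hPc.mul_mem (hPc.sq_mem _) hq)) (hPc.mul_mem hq hq'))
      (hPc.mul_mem (hPc.sq_mem _) (hPc.mul_mem hr hr'))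
  have hmain : ∀ a b, a * b ∈ P → -(a * b) ∈ P → a ∈ P ∨ b ∈ P := by
    intro a b h1 h2
    by_contra! hcon
    obtain ⟨m, hm, q, hq, r, hr, h⟩ := key a hcon.1
    obtain ⟨m', hm', q', hq', r', hr', h'⟩ := key b hcon.2
    refine hPM (m * m') (M.mul_mem hm hm') ?_
    have : -(m * m') ^ 2 = m ^ 2 * q' + m' ^ 2 * q + q * q' + -(a * b) * (r * r') := by
      linear_combination (m' ^ 2 + q') * h - a * r * h'
    rw [this]
    exact hPc.add_mem (hPc.add_mem (hPc.add_mem (hPc.mul_mem (hPc.sq_mem _) hq')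
      (hPc.mul_mem (hPc.sq_mem _) hq)) (hPc.mul_mem hq hq'))
      (hPc.mul_mem h2 (hPc.mul_mem hr hr'))
  refine ⟨P, hPc, hQP, hPM, htot, fun a b h1 h2 ↦ ?_⟩
  have e1 := hmain a b h1 h2
  have e2 := hmain (-a) b (by simpa using h2) (by simpa using h1)
  have e3 := hmain a (-b) (by simpa using h2) (by simpa using h1)
  have e4 := hmain (-a) (-b) (by simpa using h1) (by simpa using h2)
  tauto

end IsSquareCone

/-- The intermediate value property for polynomials over an ordered field, which characterizes
real closed fields. -/
def PolynomialIVT (R : Type*) [Field R] [LinearOrder R] : Prop :=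
  ∀ (p : Polynomial R) (a b : R), a < b → p.eval a * p.eval b < 0 →
    ∃ c, a < c ∧ c < b ∧ p.eval c = 0

/-- Sums of squares of elements of the subfield `E` with weights in `B`. -/
def weightedSumSq {Ω : Type*} [Field Ω] (B : Submonoid Ω) (E : Subfield Ω) : AddSubmonoid Ω :=
  AddSubmonoid.closure {y | ∃ c ∈ B, ∃ x ∈ E, y = c * x ^ 2}

section weightedSumSq

variable {Ω : Type*} [Field Ω] {B : Submonoid Ω}

theorem weightedSumSq_mono {E F : Subfield Ω} (h : E ≤ F) :
    weightedSumSq B E ≤ weightedSumSq B F :=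
  AddSubmonoid.closure_mono fun _ ⟨c, hc, x, hx, e⟩ ↦ ⟨c, hc, x, h hx, e⟩

theorem sq_mem_weightedSumSq {E : Subfield Ω} {x : Ω} (hx : x ∈ E) : x ^ 2 ∈ weightedSumSq B E :=
  AddSubmonoid.subset_closure ⟨1, B.one_mem, x, hx, by simp⟩

theorem weight_mem_weightedSumSq {E : Subfield Ω} {c : Ω} (hc : c ∈ B) :
    c ∈ weightedSumSq B E :=
  AddSubmonoid.subset_closure ⟨c, hc, 1, E.one_mem, by simp⟩

theorem mul_mem_weightedSumSq {E : Subfield Ω} {x y : Ω} (hx : x ∈ weightedSumSq B E)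
    (hy : y ∈ weightedSumSq B E) : x * y ∈ weightedSumSq B E := by
  have h := AddSubmonoid.mul_mem_mul hx hy
  rw [weightedSumSq, AddSubmonoid.closure_mul_closure] at h
  refine AddSubmonoid.closure_mono ?_ h
  rintro _ ⟨_, ⟨c, hc, x, hx, rfl⟩, _, ⟨c', hc', x', hx', rfl⟩, rfl⟩
  exact ⟨c * c', B.mul_mem hc hc', x * x', E.mul_mem hx hx', by ring⟩

theorem exists_maximal_neg_one_notMem_weightedSumSq {E₀ : Subfield Ω}
    (h₀ : (-1 : Ω) ∉ weightedSumSq B E₀) :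
    ∃ E, E₀ ≤ E ∧ Maximal (fun F : Subfield Ω ↦ (-1 : Ω) ∉ weightedSumSq B F) E := by
  refine zorn_le_nonempty₀ {F : Subfield Ω | (-1 : Ω) ∉ weightedSumSq B F} ?_ E₀ h₀
  intro c hc hchain F₀ hF₀
  refine ⟨sSup c, ?_, fun F hF ↦ le_sSup hF⟩
  have key : ∀ y ∈ weightedSumSq B (sSup c), ∃ F ∈ c, y ∈ weightedSumSq B F := by
    intro y hy
    induction hy using AddSubmonoid.closure_induction with
    | mem y hy =>
      obtain ⟨b, hb, x, hx, rfl⟩ := hy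
      obtain ⟨F, hF, hxF⟩ := (Subfield.mem_sSup_of_directedOn ⟨F₀, hF₀⟩ hchain.directedOn).1 hx
      exact ⟨F, hF, AddSubmonoid.subset_closure ⟨b, hb, x, hxF, rfl⟩⟩
    | zero => exact ⟨F₀, hF₀, zero_mem _⟩
    | add x y _ _ hx hy =>
      obtain ⟨F, hF, hxF⟩ := hx
      obtain ⟨F', hF', hyF⟩ := hy
      rcases hchain.total hF hF' with h | h
      · exact ⟨F', hF', add_mem (weightedSumSq_mono h hxF) hyF⟩
      · exact ⟨F, hF, add_mem hxF (weightedSumSq_mono h hyF)⟩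
  intro hcon
  obtain ⟨F, hF, h⟩ := key _ hcon
  exact hc hF h

end weightedSumSq

namespace Polynomial

variable {Ω : Type*} [Field Ω] {B : Submonoid Ω}

/-- A weighted sum of squares in a simple extension `E(θ)` is the value at `θ` of a nonnegative
polynomial whose degree is less than twice that of a polynomial vanishing at `θ`. -/
theorem exists_nonneg_polynomial_of_mem_weightedSumSq {E : Subfield Ω} [LinearOrder E]
    [IsStrictOrderedRing E] (hB : ∀ c ∈ B, ∃ h : c ∈ E, 0 ≤ (⟨c, h⟩ : E)) {p : E[X]} {θ : Ω}
    (hθ : aeval θ p = 0) (hp : 0 < p.natDegree) {y : Ω}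
    (hy : y ∈ weightedSumSq B (IntermediateField.adjoin E {θ}).toSubfield) :
    ∃ g : E[X], aeval θ g = y ∧ (∀ r, 0 ≤ g.eval r) ∧ g.natDegree + 2 ≤ 2 * p.natDegree := by
  have hp0 : p ≠ 0 := by rintro rfl; simp at hp
  induction hy using AddSubmonoid.closure_induction with
  | mem y hy =>
    obtain ⟨b, hb, x, hx, rfl⟩ := hy
    obtain ⟨hbE, hb0⟩ := hB b hb
    have hx' : x ∈ (IntermediateField.adjoin E {θ}).toSubalgebra := hx
    rw [IntermediateField.adjoin_simple_toSubalgebra_of_isAlgebraic ⟨p, hp0, hθ⟩,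
      Algebra.adjoin_singleton_eq_range_aeval] at hx'
    obtain ⟨g, rfl⟩ := hx'
    have hg : aeval θ (g % p) = aeval θ g := by
      conv_rhs => rw [← EuclideanDomain.mod_add_div g p]
      simp [hθ]
    refine ⟨C ⟨b, hbE⟩ * (g % p) ^ 2, ?_, ?_, ?_⟩
    · simp [hg]
      left
      rfl
    · intro r
      simp only [eval_mul, eval_C, eval_pow]
      positivity
    · have h1 : (g % p).natDegree < p.natDegree := natDegree_mod_lt g hp.ne'
      have h2 := natDegree_C_mul_le (⟨b, hbE⟩ : E) ((g % p) ^ 2)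
      have h3 := natDegree_pow_le (p := g % p) (n := 2)
      omega
  | zero => exact ⟨0, by simp, by simp, by simp; omega⟩
  | add x y _ _ hx hy =>
    obtain ⟨g, hg, hg', hgd⟩ := hx
    obtain ⟨k, hk, hk', hkd⟩ := hy
    refine ⟨g + k, by simp [hg, hk], fun r ↦ ?_, ?_⟩
    · rw [eval_add]; exact add_nonneg (hg' r) (hk' r)
    · have := natDegree_add_le g k
      omega

theorem _root_.Irreducible.root_mem_Ioo {R : Type*} [Field R] [LinearOrder R]
    [IsStrictOrderedRing R] {p : R[X]} (hp : Irreducible p) {a b c : R} (hc : p.IsRoot c)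
    (hab : a < b) (hsign : p.eval a * p.eval b < 0) : a < c ∧ c < b := by
  obtain ⟨k, hk⟩ := dvd_iff_isRoot.2 hc
  have hku : IsUnit k := (hp.isUnit_or_isUnit hk).resolve_left (not_isUnit_X_sub_C _)
  obtain ⟨u, -, rfl⟩ := Polynomial.isUnit_iff.1 hku
  rw [hk] at hsign
  simp only [eval_mul, eval_sub, eval_X, eval_C] at hsign
  constructor
  all_goals by_contra! h
  · nlinarith [mul_nonneg (mul_self_nonneg u)
      (mul_nonneg (sub_nonneg.2 h) (sub_nonneg.2 (h.trans hab.le)))]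
  · nlinarith [mul_nonneg (mul_self_nonneg u)
      (mul_nonneg (sub_nonneg.2 h) (sub_nonneg.2 (hab.le.trans h)))]

theorem polynomialIVT_of_maximal [IsAlgClosed Ω] {E : Subfield Ω} [LinearOrder E]
    [IsStrictOrderedRing E] (hB : ∀ c ∈ B, ∃ h : c ∈ E, 0 ≤ (⟨c, h⟩ : E))
    (hE : Maximal (fun F : Subfield Ω ↦ (-1 : Ω) ∉ weightedSumSq B F) E) :
    PolynomialIVT E := by
  intro p
  induction hn : p.natDegree using Nat.strong_induction_on generalizing p with
  | _ n ih =>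
  intro a b hab hsign
  have hp0 : p ≠ 0 := by rintro rfl; simp at hsign
  have hpd : 0 < p.natDegree := by
    by_contra! h
    rw [eq_C_of_natDegree_le_zero h] at hsign
    simp only [eval_C] at hsign
    nlinarith [mul_self_nonneg (p.coeff 0)]
  by_cases hirr : Irreducible p
  · obtain ⟨θ, hθ⟩ := IsAlgClosed.exists_aeval_eq_zero Ω p
      (by rw [degree_eq_natDegree hp0]; exact_mod_cast hpd.ne')
    by_cases hFR : (-1 : Ω) ∈ weightedSumSq B (IntermediateField.adjoin E {θ}).toSubfield
    · obtain ⟨g, hg, hg0, hgd⟩ := exists_nonneg_polynomial_of_mem_weightedSumSq hB hθ hpd hFR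
      have hdvd : p ∣ 1 + g := by
        have h1 : aeval θ (1 + g) = 0 := by simp [hg]
        have hθi : IsIntegral E θ := (IsAlgebraic.isIntegral ⟨p, hp0, hθ⟩)
        have h2 := (minpoly.irreducible hθi).dvd_symm hirr (minpoly.dvd E θ hθ)
        exact h2.trans (minpoly.dvd E θ h1)
      obtain ⟨k, hk⟩ := hdvd
      have hev : ∀ r, 0 < p.eval r * k.eval r := by
        intro r
        have := congrArg (eval r) hk
        simp only [eval_add, eval_one, eval_mul] at this
        rw [← this]
        linarith [hg0 r]
      have hk0 : k ≠ 0 := by rintro rfl; simpa using hev 0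
      have hdeg : k.natDegree < n := by
        have h1 := natDegree_mul hp0 hk0
        rw [← hk] at h1
        have h2 := natDegree_add_le 1 g
        simp only [natDegree_one] at h2
        omega
      obtain ⟨c, hc1, hc2, hc⟩ := ih _ hdeg k rfl a b hab (by
        have h1 := mul_pos (hev a) (hev b)
        by_contra! h
        nlinarith)
      simpa [hc] using hev c
    · have hle : E ≤ (IntermediateField.adjoin E {θ}).toSubfield := by
        intro x hx
        exact (IntermediateField.adjoin E {θ}).algebraMap_mem ⟨x, hx⟩
      have hθE : θ ∈ E := hE.le_of_ge hFR hle (IntermediateField.mem_adjoin_simple_self E θ)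
      have hroot : p.IsRoot ⟨θ, hθE⟩ := by
        have : algebraMap E Ω (p.eval ⟨θ, hθE⟩) = 0 := by
          rw [← aeval_algebraMap_apply_eq_algebraMap_eval]
          exact hθ
        simpa using this
      obtain ⟨h1, h2⟩ := hirr.root_mem_Ioo hroot hab hsign
      exact ⟨⟨θ, hθE⟩, h1, h2, hroot⟩
  · have hnu : ¬ IsUnit p := not_isUnit_of_natDegree_pos p hpd
    rw [irreducible_iff] at hirr
    push Not at hirr
    obtain ⟨q, r, rfl, hq, hr⟩ := hirr hnu
    have hq0 := left_ne_zero_of_mul hp0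
    have hr0 := right_ne_zero_of_mul hp0
    have hdeg := natDegree_mul hq0 hr0
    have hqd : 0 < q.natDegree := by
      rw [Nat.pos_iff_ne_zero]
      exact fun h ↦ hq (isUnit_iff_degree_eq_zero.2 (by rw [degree_eq_natDegree hq0, h]; rfl))
    have hrd : 0 < r.natDegree := by
      rw [Nat.pos_iff_ne_zero]
      exact fun h ↦ hr (isUnit_iff_degree_eq_zero.2 (by rw [degree_eq_natDegree hr0, h]; rfl))
    simp only [eval_mul] at hsign ⊢
    rcases lt_or_ge (q.eval a * q.eval b) 0 with h | h
    · obtain ⟨c, h1, h2, h3⟩ := ih _ (by omega) q rfl a b hab h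
      exact ⟨c, h1, h2, by simp [h3]⟩
    · obtain ⟨c, h1, h2, h3⟩ := ih _ (by omega) r rfl a b hab (by
        by_contra! h'
        exact hsign.not_ge (by convert mul_nonneg h h' using 1; ring))
      exact ⟨c, h1, h2, by simp [h3]⟩

end Polynomial

/-- A prime cone `P` in a commutative ring is the pullback of the cone of nonnegative elements of
some real closed field. -/
theorem exists_ringHom_polynomialIVT.{u} {A : Type u} [CommRing A] {P : Set A} (hP : IsSquareCone P)
    (hneg : (-1 : A) ∉ P) (htot : ∀ a, a ∈ P ∨ -a ∈ P)
    (hprime : ∀ a b, a * b ∈ P → -(a * b) ∈ P → (a ∈ P ∧ -a ∈ P) ∨ (b ∈ P ∧ -b ∈ P)) :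
    ∃ (R : Type u) (_ : Field R) (_ : LinearOrder R) (_ : IsStrictOrderedRing R) (φ : A →+* R),
      PolynomialIVT R ∧ (∀ a ∈ P, 0 ≤ φ a) ∧ ∀ a, φ a = 0 → a ∈ P ∧ -a ∈ P := by
  classical
  let I : Ideal A :=
    { carrier := {a | a ∈ P ∧ -a ∈ P}
      zero_mem' := by simpa using hP.zero_mem
      add_mem' := fun {a b} ha hb ↦ ⟨hP.add_mem ha.1 hb.1, by
        rw [neg_add]; exact hP.add_mem ha.2 hb.2⟩
      smul_mem' := fun c a ha ↦ by
        rcases htot c with h | h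
        · exact ⟨hP.mul_mem h ha.1, by simpa using hP.mul_mem h ha.2⟩
        · exact ⟨by simpa using hP.mul_mem h ha.2, by simpa using hP.mul_mem h ha.1⟩ }
  have hI : I.IsPrime :=
    ⟨(Ideal.ne_top_iff_one I).2 fun h ↦ hneg h.2, fun {a b} h ↦ hprime a b h.1 h.2⟩
  let Ω := AlgebraicClosure (FractionRing (A ⧸ I))
  let ι : A →+* Ω := (algebraMap (FractionRing (A ⧸ I)) Ω).comp
    ((algebraMap (A ⧸ I) (FractionRing (A ⧸ I))).comp (Ideal.Quotient.mk I))
  have hι : ∀ a, ι a = 0 ↔ a ∈ P ∧ -a ∈ P := by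
    intro a
    rw [show (a ∈ P ∧ -a ∈ P) ↔ a ∈ I from Iff.rfl, ← Ideal.Quotient.eq_zero_iff_mem]
    simp [ι]
  let B : Submonoid Ω :=
    { carrier := ι '' P
      one_mem' := ⟨1, hP.one_mem, map_one ι⟩
      mul_mem' := by
        rintro _ _ ⟨a, ha, rfl⟩ ⟨b, hb, rfl⟩
        exact ⟨a * b, hP.mul_mem ha hb, map_mul ι a b⟩ }
  let E₀ : Subfield Ω := (algebraMap (FractionRing (A ⧸ I)) Ω).fieldRange
  have hfrac : ∀ y ∈ weightedSumSq B E₀, ∃ d, ι d ≠ 0 ∧ ∃ c ∈ P, y * ι d ^ 2 = ι c := by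
    intro y hy
    induction hy using AddSubmonoid.closure_induction with
    | mem y hy =>
      obtain ⟨_, ⟨c, hc, rfl⟩, _, ⟨x, rfl⟩, rfl⟩ := hy
      obtain ⟨u, v, hv, rfl⟩ := IsFractionRing.div_surjective (A := A ⧸ I) x
      obtain ⟨u, rfl⟩ := Ideal.Quotient.mk_surjective u
      obtain ⟨d, rfl⟩ := Ideal.Quotient.mk_surjective v
      have hd : ι d ≠ 0 := by
        simpa [ι] using nonZeroDivisors.ne_zero hv
      refine ⟨d, hd, c * u ^ 2, hP.mul_mem hc (hP.sq_mem u), ?_⟩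
      have : algebraMap (FractionRing (A ⧸ I)) Ω
        (algebraMap (A ⧸ I) (FractionRing (A ⧸ I)) (Ideal.Quotient.mk I u) /
          algebraMap (A ⧸ I) (FractionRing (A ⧸ I)) (Ideal.Quotient.mk I d)) = ι u / ι d := by
        rw [map_div₀]; rfl
      rw [this, map_mul, map_pow, mul_assoc, ← mul_pow, div_mul_cancel₀ _ hd]
    | zero => exact ⟨1, by simp, 0, hP.zero_mem, by simp⟩
    | add x y _ _ hx hy =>
      obtain ⟨d, hd, c, hc, h⟩ := hx
      obtain ⟨d', hd', c', hc', h'⟩ := hy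
      refine ⟨d * d', by simp [hd, hd'], c * d' ^ 2 + c' * d ^ 2,
        hP.add_mem (hP.mul_mem hc (hP.sq_mem _)) (hP.mul_mem hc' (hP.sq_mem _)), ?_⟩
      simp only [map_mul, map_add, map_pow]
      linear_combination ι d' ^ 2 * h + ι d ^ 2 * h'
  have hE₀ : (-1 : Ω) ∉ weightedSumSq B E₀ := by
    intro hcon
    obtain ⟨d, hd, c, hc, h⟩ := hfrac _ hcon
    have h1 : ι (c + d ^ 2) = 0 := by
      rw [map_add, map_pow]; linear_combination -h
    have h2 := ((hι _).1 h1).2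
    have h3 : -(d * d) ∈ P := by
      have := hP.add_mem hc h2
      convert this using 1; ring
    have h4 := hprime d d (by simpa [sq] using hP.sq_mem d) h3
    exact hd ((hι d).2 (by tauto))
  obtain ⟨E, hE₀E, hE⟩ := exists_maximal_neg_one_notMem_weightedSumSq hE₀
  have hιE : ∀ a, ι a ∈ E := fun a ↦ hE₀E ⟨_, rfl⟩
  let T : Set E := {x | (x : Ω) ∈ weightedSumSq B E}
  have hT : IsSquareCone T :=
    { add_mem := fun hx hy ↦ (weightedSumSq B E).add_mem hx hy
      mul_mem := fun hx hy ↦ mul_mem_weightedSumSq hx hy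
      sq_mem := fun x ↦ sq_mem_weightedSumSq x.2 }
  obtain ⟨Q, hQ, hTQ, hQ1, hQtot, -⟩ := hT.exists_prime_extension ⊥ (by
    intro m hm
    rw [Submonoid.mem_bot] at hm
    subst hm
    simpa [T] using hE.prop)
  have hQneg : (-1 : E) ∉ Q := by simpa using hQ1 1 (Submonoid.one_mem _)
  let K : RingCone E :=
    { carrier := Q
      zero_mem' := hQ.zero_mem
      one_mem' := hQ.one_mem
      add_mem' := hQ.add_mem
      mul_mem' := hQ.mul_mem
      eq_zero_of_mem_of_neg_mem' := by
        intro x hx hx'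
        by_contra h0
        apply hQneg
        have := hQ.mul_mem (hQ.mul_mem hx hx') (hQ.sq_mem x⁻¹)
        convert this using 1
        field_simp }
  have : HasMemOrNegMem K := ⟨fun x ↦ hQtot x⟩
  let : LinearOrder E := LinearOrder.mkOfAddGroupCone K
  have : IsOrderedRing E := IsOrderedRing.mkOfCone K
  have : IsStrictOrderedRing E := IsOrderedRing.toIsStrictOrderedRing E
  have hnonneg : ∀ x : E, x ∈ Q → 0 ≤ x := by
    intro x hx
    change x - 0 ∈ Q
    simpa using hx
  have hBE : ∀ a ∈ P, 0 ≤ (⟨ι a, hιE a⟩ : E) :=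
    fun a ha ↦ hnonneg _ (hTQ (weight_mem_weightedSumSq ⟨a, ha, rfl⟩))
  refine ⟨E, inferInstance, inferInstance, inferInstance, ι.codRestrict E hιE, ?_, hBE, ?_⟩
  · refine Polynomial.polynomialIVT_of_maximal ?_ hE
    rintro _ ⟨a, ha, rfl⟩
    exact ⟨hιE a, hBE a ha⟩
  · intro a ha
    exact (hι a).1 (congrArg Subtype.val ha)

namespace Polynomial

section OrderedField

variable {R : Type*} [Field R] [LinearOrder R] [IsStrictOrderedRing R]

theorem exists_eval_lt_zero_right (p : R[X]) {a b : R} (hab : a < b) (ha : p.eval a < 0) :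
    ∃ c, a < c ∧ c < b ∧ p.eval c < 0 := by
  let _ : TopologicalSpace R := Preorder.topology R
  have : OrderTopology R := ⟨rfl⟩
  have h : ∀ᶠ x in nhds a, p.eval x < 0 := p.continuous.continuousAt.eventually_lt_const ha
  obtain ⟨c, hc, h1, h2⟩ := ((h.filter_mono nhdsWithin_le_nhds).and
    (Ioo_mem_nhdsGT hab)).exists
  exact ⟨c, h1, h2, hc⟩

theorem exists_eval_lt_zero_left (p : R[X]) {a b : R} (hab : a < b) (hb : p.eval b < 0) :
    ∃ c, a < c ∧ c < b ∧ p.eval c < 0 := by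
  obtain ⟨c, h1, h2, h3⟩ := exists_eval_lt_zero_right (p.comp (-X)) (neg_lt_neg hab)
    (by simpa using hb)
  exact ⟨-c, by linarith, by linarith, by simpa using h3⟩

theorem exists_eval_ne_zero {p : R[X]} (hp : p ≠ 0) {a b : R} (hab : a < b) :
    ∃ c, a < c ∧ c < b ∧ p.eval c ≠ 0 := by
  by_contra! h
  exact hp (eq_zero_of_infinite_isRoot p ((Set.Ioo_infinite hab).mono fun c hc ↦ h c hc.1 hc.2))

theorem exists_le_abs_eval {p : R[X]} (hp : p ≠ 0) :
    ∃ ε > 0, ∃ M, ∀ x, M < |x| → ε ≤ |p.eval x| := by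
  induction hn : p.natDegree using Nat.strong_induction_on generalizing p with
  | _ n ih =>
  by_cases h0 : p.natDegree = 0
  · rw [eq_C_of_natDegree_eq_zero h0] at hp ⊢
    refine ⟨|p.coeff 0|, by simpa using hp, 0, fun x _ ↦ by simp⟩
  · have hq : p.divX ≠ 0 := by
      intro h
      have := p.divX_mul_X_add
      rw [h] at this
      apply h0
      rw [← this]
      simp
    obtain ⟨ε, hε, M, hM⟩ := ih p.divX.natDegree
      (by rw [natDegree_divX_eq_natDegree_tsub_one]; omega) hq rfl
    refine ⟨1, one_pos, max M ((1 + |p.coeff 0|) / ε), fun x hx ↦ ?_⟩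
    have h1 := hM x ((le_max_left _ _).trans_lt hx)
    have h2 := (le_max_right _ _).trans_lt hx
    rw [div_lt_iff₀ hε] at h2
    have h3 : p.eval x = p.divX.eval x * x + p.coeff 0 := by
      conv_lhs => rw [← p.divX_mul_X_add]
      simp
    have h4 := abs_sub_abs_le_abs_sub (p.divX.eval x * x) (-p.coeff 0)
    rw [sub_neg_eq_add, ← h3, abs_mul, abs_neg] at h4
    nlinarith [abs_nonneg x]

/-- Nonconstant polynomials are unbounded in both directions. -/
theorem exists_lt_abs_eval {p : R[X]} (hp : derivative p ≠ 0) (B : R) :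
    ∃ M, ∀ x, M < |x| → B < |p.eval x| := by
  have hq : p.divX ≠ 0 := by
    intro h
    have := p.divX_mul_X_add
    rw [h] at this
    apply hp
    rw [← this]
    simp
  obtain ⟨ε, hε, M, hM⟩ := exists_le_abs_eval hq
  refine ⟨max M ((|B| + |p.coeff 0|) / ε), fun x hx ↦ ?_⟩
  have h1 := hM x ((le_max_left _ _).trans_lt hx)
  have h2 := (le_max_right _ _).trans_lt hx
  rw [div_lt_iff₀ hε] at h2
  have h3 : p.eval x = p.divX.eval x * x + p.coeff 0 := by
    conv_lhs => rw [← p.divX_mul_X_add]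
    simp
  have h4 := abs_sub_abs_le_abs_sub (p.divX.eval x * x) (-p.coeff 0)
  rw [sub_neg_eq_add, ← h3, abs_mul, abs_neg] at h4
  nlinarith [abs_nonneg x, le_abs_self B]

theorem exists_lt_and_lt_abs_eval {p : R[X]} (hp : derivative p ≠ 0) (B a : R) :
    ∃ b < a, B < |p.eval b| := by
  obtain ⟨M, hM⟩ := exists_lt_abs_eval hp B
  refine ⟨-(|a| + |M| + 1), ?_, hM _ ?_⟩
  · linarith [neg_abs_le a, abs_nonneg M]
  · rw [abs_neg, abs_of_pos (by positivity)]
    linarith [le_abs_self M, abs_nonneg a]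

end OrderedField

section PolynomialIVT

variable {R : Type*} [Field R] [LinearOrder R]

theorem _root_.PolynomialIVT.sign_eval_eq [IsStrictOrderedRing R] (hR : PolynomialIVT R) (p : R[X])
    {a b : R} (hab : a ≤ b) (h : ∀ c, a ≤ c → c ≤ b → p.eval c ≠ 0) :
    SignType.sign (p.eval a) = SignType.sign (p.eval b) := by
  rcases hab.eq_or_lt with rfl | hab
  · rfl
  have ha := h a le_rfl hab.le
  have hb := h b hab.le le_rfl
  have key : ¬ p.eval a * p.eval b < 0 := by
    intro hneg
    obtain ⟨c, h1, h2, h3⟩ := hR p a b hab hneg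
    exact h c h1.le h2.le h3
  rcases lt_or_gt_of_ne ha with ha | ha <;> rcases lt_or_gt_of_ne hb with hb | hb
  · rw [sign_neg ha, sign_neg hb]
  · exact absurd (mul_neg_of_neg_of_pos ha hb) key
  · exact absurd (mul_neg_of_pos_of_neg ha hb) key
  · rw [sign_pos ha, sign_pos hb]

variable [IsStrictOrderedRing R]

theorem _root_.PolynomialIVT.eval_lt_eval_of_Icc (hR : PolynomialIVT R) (p : R[X]) {a b : R}
    (hab : a < b) (h : ∀ c, a ≤ c → c ≤ b → 0 < p.derivative.eval c) : p.eval a < p.eval b := by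
  by_contra! hle
  obtain ⟨q, hq⟩ : X - C a ∣ p - C (p.eval a) := X_sub_C_dvd_sub_C_eval
  have hp : p = (X - C a) * q + C (p.eval a) := by rw [← hq]; ring
  have hqa : 0 < q.eval a := by
    have h1 := h a le_rfl hab.le
    rw [hp] at h1
    simpa using h1
  have hq0 : q ≠ 0 := by rintro rfl; simp at hqa
  have hqx : ∀ x, p.eval x - p.eval a = (x - a) * q.eval x := by
    intro x
    have := congrArg (eval x) hq
    simpa using this
  have hqb : q.eval b ≤ 0 := by
    by_contra! hcon
    have := mul_pos (sub_pos.2 hab) hcon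
    rw [← hqx] at this
    linarith
  have hroot : ∃ c, a < c ∧ c ≤ b ∧ q.eval c = 0 := by
    rcases hqb.eq_or_lt with h0 | h0
    · exact ⟨b, hab, le_rfl, h0⟩
    · obtain ⟨c, h1, h2, h3⟩ := hR q a b hab (mul_neg_of_pos_of_neg hqa h0)
      exact ⟨c, h1, h2.le, h3⟩
  obtain ⟨c, ⟨hc1, hc2, hc3⟩, hcmin⟩ := Set.exists_min_image {c | a < c ∧ c ≤ b ∧ q.eval c = 0} id
    ((q.rootSet_finite R).subset fun c hc ↦ by simpa [mem_rootSet, hq0] using hc.2.2) hroot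
  obtain ⟨w, rfl⟩ := dvd_iff_isRoot.2 hc3
  have hwc : 0 < w.eval c := by
    have h1 := h c hc1.le hc2
    rw [hp] at h1
    simp only [derivative_add, derivative_mul, derivative_sub, derivative_X, derivative_C, eval_add,
      eval_mul, eval_sub, eval_X, eval_C, eval_one, eval_zero, sub_self] at h1
    have h2 : 0 < (c - a) * w.eval c := by linarith
    exact pos_of_mul_pos_right h2 (sub_pos.2 hc1).le
  have hwa : w.eval a < 0 := by
    simp only [eval_mul, eval_sub, eval_X, eval_C] at hqa
    by_contra! hcon
    nlinarith
  obtain ⟨d, hd1, hd2, hd3⟩ := hR w a c hc1 (mul_neg_of_neg_of_pos hwa hwc)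
  exact hd2.not_ge (hcmin d ⟨hd1, hd2.le.trans hc2, by simp [hd3]⟩)

/-- A polynomial with positive derivative on an open interval is increasing up to the endpoints. -/
theorem _root_.PolynomialIVT.eval_lt_eval (hR : PolynomialIVT R) (p : R[X]) {a b : R}
    (hab : a < b) (h : ∀ c, a < c → c < b → 0 < p.derivative.eval c) : p.eval a < p.eval b := by
  obtain ⟨x, hax, hxb⟩ := exists_between hab
  obtain ⟨y, hxy, hyb⟩ := exists_between hxb
  have hmono : ∀ s t, a < s → s < t → t < b → p.eval s < p.eval t := fun s t h1 h2 h3 ↦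
    hR.eval_lt_eval_of_Icc p h2 fun c hc1 hc2 ↦ h c (h1.trans_le hc1) (hc2.trans_lt h3)
  have h1 : p.eval a ≤ p.eval x := by
    by_contra! hcon
    obtain ⟨s, hs1, hs2, hs3⟩ := exists_eval_lt_zero_right (C (p.eval x) - p) hax
      (by simpa using hcon)
    have := hmono s x hs1 hs2 hxb
    simp only [eval_sub, eval_C] at hs3
    linarith
  have h2 : p.eval y ≤ p.eval b := by
    by_contra! hcon
    obtain ⟨s, hs1, hs2, hs3⟩ := exists_eval_lt_zero_left (p - C (p.eval y)) hyb
      (by simpa using hcon)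
    have := hmono y s (hax.trans hxy) hs1 hs2
    simp only [eval_sub, eval_C] at hs3
    linarith
  exact h1.trans_lt ((hmono x y hax hxy hyb).trans_le h2)

end PolynomialIVT

end Polynomial

namespace Polynomial

/-- The map `f` preserves the signs of the values of the polynomials `u i`, turning them into those
of the polynomials `v i`. -/
def PreservesSigns {R R' ι : Type*} [Field R] [LinearOrder R] [Field R'] [LinearOrder R']
    (u : ι → R[X]) (v : ι → R'[X]) (f : R → R') : Prop :=
  ∀ i a, SignType.sign ((v i).eval (f a)) = SignType.sign ((u i).eval a)

theorem PreservesSigns.eval_eq_zero_iff {R R' ι : Type*} [Field R] [LinearOrder R] [Field R']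
    [LinearOrder R'] {u : ι → R[X]} {v : ι → R'[X]} {f : R → R'} (hf : PreservesSigns u v f)
    (i : ι) (a : R) : (v i).eval (f a) = 0 ↔ (u i).eval a = 0 := by
  rw [← sign_eq_zero_iff, hf i a, sign_eq_zero_iff]

section RootOrder

variable {R R' : Type*} [Field R] [LinearOrder R] [IsStrictOrderedRing R] [Field R'] [LinearOrder R']
  {ι : Type*} {u : ι → R[X]} {v : ι → R'[X]}

theorem PreservesSigns.lt_of_root_lt {f : R → R'} (hf : PreservesSigns u v f) (hmono : Monotone f)
    {i : ι} (hu : u i ≠ 0) {a b : R} (ha : (u i).eval a = 0) (hab : a < b) : f a < f b := by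
  obtain ⟨c, hc1, hc2, hc3⟩ := exists_eval_ne_zero hu hab
  refine (lt_of_le_of_ne (hmono hc1.le) fun h ↦ hc3 ?_).trans_le (hmono hc2.le)
  rw [← hf.eval_eq_zero_iff, ← h, hf.eval_eq_zero_iff, ha]

theorem PreservesSigns.lt_of_lt_root {f : R → R'} (hf : PreservesSigns u v f) (hmono : Monotone f)
    {i : ι} (hu : u i ≠ 0) {a b : R} (hb : (u i).eval b = 0) (hab : a < b) : f a < f b := by
  obtain ⟨c, hc1, hc2, hc3⟩ := exists_eval_ne_zero hu hab
  refine (hmono hc1.le).trans_lt (lt_of_le_of_ne (hmono hc2.le) fun h ↦ hc3 ?_)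
  rw [← hf.eval_eq_zero_iff, h, hf.eval_eq_zero_iff, hb]

theorem PreservesSigns.card_roots_le {f : R → R'} (hf : PreservesSigns u v f) (hmono : Monotone f)
    {i : ι} (hu : u i ≠ 0) (hv : v i ≠ 0) :
    ((u i).roots.toFinset.image f).card = (u i).roots.toFinset.card ∧
      (u i).roots.toFinset.image f ⊆ (v i).roots.toFinset := by
  constructor
  · refine Finset.card_image_of_injOn fun a ha b hb hab ↦ ?_
    have ha' : (u i).eval a = 0 := by simpa [hu] using ha
    have hb' : (u i).eval b = 0 := by simpa [hu] using hb
    rcases lt_trichotomy a b with h | h | h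
    · exact absurd hab (hf.lt_of_root_lt hmono hu ha' h).ne
    · exact h
    · exact absurd hab (hf.lt_of_root_lt hmono hu hb' h).ne'
  · intro b hb
    obtain ⟨a, ha, rfl⟩ := Finset.mem_image.1 hb
    have ha' : (u i).eval a = 0 := by simpa [hu] using ha
    simpa [hv] using (hf.eval_eq_zero_iff i a).2 ha'

end RootOrder

section Transfer

variable {R R' : Type*} [Field R] [LinearOrder R] [IsStrictOrderedRing R]
  [Field R'] [LinearOrder R'] [IsStrictOrderedRing R']

theorem exists_eval_lt_zero_in_gap (hR : PolynomialIVT R) (hR' : PolynomialIVT R')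
    {p : R[X]} {q : R'[X]} {Z : Set R} (hZ : Z.Finite) {f : R → R'} (hf : Monotone f)
    (hpZ : ∀ x, p.derivative.eval x = 0 → x ∈ Z)
    (hqZ : ∀ y, q.derivative.eval y = 0 → ∃ z ∈ Z, f z = y)
    (hpq : ∀ z ∈ Z, SignType.sign (q.eval (f z)) = SignType.sign (p.eval z))
    {a : R} {b : R'} (ha : a ∉ Z) (hgap : ∀ z ∈ Z, (z < a → f z < b) ∧ (a < z → b < f z))
    (hpa : 0 < p.derivative.eval a) (hqb : 0 < q.derivative.eval b) (hp : p.eval a ≤ 0) :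
    ∃ c ≤ b, (∀ z ∈ Z, z < a → f z < c) ∧ q.eval c < 0 := by
  by_cases hne : ({z ∈ Z | z < a} : Set R).Nonempty
  · obtain ⟨u, ⟨huZ, hua⟩, humax⟩ := Set.exists_max_image _ id (hZ.subset (Set.sep_subset _ _)) hne
    have h1 : p.eval u < p.eval a := by
      refine hR.eval_lt_eval p hua fun c hc1 hc2 ↦ ?_
      rw [← sign_eq_one_iff, hR.sign_eval_eq _ hc2.le, sign_pos hpa]
      intro d hd1 hd2 hd
      rcases hd2.eq_or_lt with rfl | hd2
      · exact ha (hpZ _ hd)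
      · exact (hc1.trans_le hd1).not_ge (humax d ⟨hpZ _ hd, hd2⟩)
    have h2 : q.eval (f u) < 0 := by
      rw [← sign_eq_neg_one_iff, hpq u huZ, sign_eq_neg_one_iff]
      exact h1.trans_le hp
    obtain ⟨c, hc1, hc2, hc3⟩ := exists_eval_lt_zero_right q ((hgap u huZ).1 hua) h2
    exact ⟨c, hc2.le, fun z hz hza ↦ (hf (humax z ⟨hz, hza⟩)).trans_lt hc1, hc3⟩
  · have hlow : ∀ z ∈ Z, ¬ z < a := fun z hz hza ↦ hne ⟨z, hz, hza⟩
    obtain ⟨c, hcb, hc⟩ := exists_lt_and_lt_abs_eval (p := q)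
      (by intro h; simp [h] at hqb) |q.eval b| b
    have h1 : q.eval c < q.eval b := by
      refine hR'.eval_lt_eval q hcb fun d hd1 hd2 ↦ ?_
      rw [← sign_eq_one_iff, hR'.sign_eval_eq _ hd2.le, sign_pos hqb]
      intro e he1 he2 he
      obtain ⟨z, hz, rfl⟩ := hqZ e he
      rcases lt_trichotomy z a with h | rfl | h
      · exact hlow z hz h
      · exact ha hz
      · exact ((hgap z hz).2 h).not_ge he2
    refine ⟨c, hcb.le, fun z hz hza ↦ absurd hza (hlow z hz), ?_⟩
    by_contra! hcon
    rw [abs_of_nonneg hcon] at hc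
    exact absurd (hc.trans h1) (le_abs_self _).not_gt

theorem exists_zero_lt_eval_in_gap (hR : PolynomialIVT R) (hR' : PolynomialIVT R')
    {p : R[X]} {q : R'[X]} {Z : Set R} (hZ : Z.Finite) {f : R → R'} (hf : Monotone f)
    (hpZ : ∀ x, p.derivative.eval x = 0 → x ∈ Z)
    (hqZ : ∀ y, q.derivative.eval y = 0 → ∃ z ∈ Z, f z = y)
    (hpq : ∀ z ∈ Z, SignType.sign (q.eval (f z)) = SignType.sign (p.eval z))
    {a : R} {b : R'} (ha : a ∉ Z) (hgap : ∀ z ∈ Z, (z < a → f z < b) ∧ (a < z → b < f z))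
    (hpa : 0 < p.derivative.eval a) (hqb : 0 < q.derivative.eval b) (hp : 0 ≤ p.eval a) :
    ∃ c ≥ b, (∀ z ∈ Z, a < z → c < f z) ∧ 0 < q.eval c := by
  obtain ⟨c, hc1, hc2, hc3⟩ := exists_eval_lt_zero_in_gap hR hR' (p := -p.comp (-X))
    (q := -q.comp (-X)) (Z := -Z) hZ.neg (f := fun x ↦ -f (-x)) (a := -a) (b := -b)
    (fun x y h ↦ neg_le_neg (hf (neg_le_neg h)))
    (fun x hx ↦ hpZ (-x) (by simpa [derivative_comp] using hx))
    (fun y hy ↦ by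
      obtain ⟨z, hz, h⟩ := hqZ (-y) (by simpa [derivative_comp] using hy)
      exact ⟨-z, by simpa using hz, by simp [h]⟩)
    (fun z hz ↦ by simpa [Left.sign_neg] using hpq (-z) hz)
    (by simpa using ha)
    (fun z hz ↦ ⟨fun h ↦ neg_lt_neg ((hgap (-z) hz).2 (by linarith)),
      fun h ↦ neg_lt_neg ((hgap (-z) hz).1 (by linarith))⟩)
    (by simpa [derivative_comp] using hpa) (by simpa [derivative_comp] using hqb)
    (by simpa using hp)
  refine ⟨-c, by simpa using neg_le_neg hc1, fun z hz h ↦ ?_, by simpa using hc3⟩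
  have := hc2 (-z) (by simpa using hz) (neg_lt_neg h)
  simp only [neg_neg] at this
  linarith

theorem exists_sign_eval_eq_in_gap_of_pos (hR : PolynomialIVT R) (hR' : PolynomialIVT R')
    {p : R[X]} {q : R'[X]} {Z : Set R} (hZ : Z.Finite) {f : R → R'} (hf : Monotone f)
    (hpZ : ∀ x, p.derivative.eval x = 0 → x ∈ Z)
    (hqZ : ∀ y, q.derivative.eval y = 0 → ∃ z ∈ Z, f z = y)
    (hpq : ∀ z ∈ Z, SignType.sign (q.eval (f z)) = SignType.sign (p.eval z))
    {a : R} {b : R'} (ha : a ∉ Z) (hgap : ∀ z ∈ Z, (z < a → f z < b) ∧ (a < z → b < f z))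
    (hpa : 0 < p.derivative.eval a) (hqb : 0 < q.derivative.eval b) :
    ∃ c, (∀ z ∈ Z, (z < a → f z < c) ∧ (a < z → c < f z)) ∧
      SignType.sign (q.eval c) = SignType.sign (p.eval a) := by
  have hlow := exists_eval_lt_zero_in_gap hR hR' hZ hf hpZ hqZ hpq ha hgap hpa hqb
  have hupp := exists_zero_lt_eval_in_gap hR hR' hZ hf hpZ hqZ hpq ha hgap hpa hqb
  rcases lt_trichotomy (p.eval a) 0 with h | h | h
  · obtain ⟨c, hc1, hc2, hc3⟩ := hlow h.le
    exact ⟨c, fun z hz ↦ ⟨hc2 z hz, fun hz' ↦ hc1.trans_lt ((hgap z hz).2 hz')⟩,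
      by rw [sign_neg hc3, sign_neg h]⟩
  · obtain ⟨c, hc1, hc2, hc3⟩ := hlow h.le
    obtain ⟨d, hd1, hd2, hd3⟩ := hupp h.ge
    have hcd : c < d := lt_of_le_of_ne (hc1.trans hd1) (by rintro rfl; exact hc3.not_gt hd3)
    obtain ⟨e, he1, he2, he3⟩ := hR' q c d hcd (mul_neg_of_neg_of_pos hc3 hd3)
    exact ⟨e, fun z hz ↦ ⟨fun hz' ↦ (hc2 z hz hz').trans he1, fun hz' ↦ he2.trans (hd2 z hz hz')⟩,
      by rw [he3, h, sign_zero, sign_zero]⟩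
  · obtain ⟨c, hc1, hc2, hc3⟩ := hupp h.le
    exact ⟨c, fun z hz ↦ ⟨fun hz' ↦ ((hgap z hz).1 hz').trans_le hc1, hc2 z hz⟩,
      by rw [sign_pos hc3, sign_pos h]⟩

theorem exists_sign_eval_eq_in_gap (hR : PolynomialIVT R) (hR' : PolynomialIVT R')
    {p : R[X]} {q : R'[X]} {Z : Set R} (hZ : Z.Finite) {f : R → R'} (hf : Monotone f)
    (hpZ : ∀ x, p.derivative.eval x = 0 → x ∈ Z)
    (hqZ : ∀ y, q.derivative.eval y = 0 → ∃ z ∈ Z, f z = y)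
    (hpq : ∀ z ∈ Z, SignType.sign (q.eval (f z)) = SignType.sign (p.eval z))
    {a : R} {b : R'} (ha : a ∉ Z) (hgap : ∀ z ∈ Z, (z < a → f z < b) ∧ (a < z → b < f z))
    (hab : SignType.sign (q.derivative.eval b) = SignType.sign (p.derivative.eval a)) :
    ∃ c, (∀ z ∈ Z, (z < a → f z < c) ∧ (a < z → c < f z)) ∧
      SignType.sign (q.eval c) = SignType.sign (p.eval a) := by
  rcases lt_trichotomy (p.derivative.eval a) 0 with h | h | h
  · have h' : q.derivative.eval b < 0 := by
      rw [← sign_eq_neg_one_iff, hab, sign_neg h]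
    obtain ⟨c, hc1, hc2⟩ := exists_sign_eval_eq_in_gap_of_pos hR hR' (p := -p) (q := -q) hZ hf
      (fun x hx ↦ hpZ x (by simpa using hx)) (fun y hy ↦ hqZ y (by simpa using hy))
      (fun z hz ↦ by simpa [Left.sign_neg] using hpq z hz) ha hgap (by simpa using h)
      (by simpa using h')
    exact ⟨c, hc1, by simpa [Left.sign_neg] using hc2⟩
  · exact absurd (hpZ a h) ha
  · have h' : 0 < q.derivative.eval b := by
      rw [← sign_eq_one_iff, hab, sign_pos h]
    exact exists_sign_eval_eq_in_gap_of_pos hR hR' hZ hf hpZ hqZ hpq ha hgap h h'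

variable {ι : Type*} {u : ι → R[X]} {v : ι → R'[X]}

theorem PreservesSigns.exists_root {f : R → R'} (hf : PreservesSigns u v f) (hmono : Monotone f)
    {g : R' → R} (hg : PreservesSigns v u g) (hgmono : Monotone g)
    {i : ι} (hu : u i ≠ 0) (hv : v i ≠ 0) {b : R'} (hb : (v i).eval b = 0) :
    ∃ a, (u i).eval a = 0 ∧ f a = b := by
  obtain ⟨h1, h2⟩ := hf.card_roots_le hmono hu hv
  obtain ⟨h3, h4⟩ := hg.card_roots_le hgmono hv hu
  have h5 := Finset.card_le_card h4
  have h6 := Finset.eq_of_subset_of_card_le h2 (by omega)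
  have h7 : b ∈ (u i).roots.toFinset.image f := by
    rw [h6]
    simpa [hv] using hb
  obtain ⟨a, ha, rfl⟩ := Finset.mem_image.1 h7
  exact ⟨a, by simpa [hu] using ha, rfl⟩

/-- Monotone sign-preserving maps for a family of polynomials containing the derivative of `p`
yield such a map for the family enlarged by `p`, provided that they respect the signs of `p` at the
roots of the family. -/
theorem PreservesSigns.exists_extension [Finite ι] (hR : PolynomialIVT R) (hR' : PolynomialIVT R')
    (hu : ∀ i, u i ≠ 0) (hv : ∀ i, v i ≠ 0)
    {f : R → R'} (hf : PreservesSigns u v f) (hmono : Monotone f)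
    {g : R' → R} (hg : PreservesSigns v u g) (hgmono : Monotone g)
    {p : R[X]} {q : R'[X]} {i₀ : ι} (hp : derivative p = u i₀) (hq : derivative q = v i₀)
    (hroot : ∀ i a, (u i).eval a = 0 →
      SignType.sign (q.eval (f a)) = SignType.sign (p.eval a)) :
    ∃ F : R → R', Monotone F ∧ PreservesSigns u v F ∧
      ∀ a, SignType.sign (q.eval (F a)) = SignType.sign (p.eval a) := by
  classical
  let Z : Set R := {a | ∃ i, (u i).eval a = 0}
  have hZ : Z.Finite := by
    have : Z = ⋃ i, {a | (u i).eval a = 0} := by ext; simp [Z]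
    rw [this]
    refine Set.finite_iUnion fun i ↦ ((u i).rootSet_finite R).subset fun c hc ↦ ?_
    simpa [mem_rootSet, hu i] using hc
  have hfgap : ∀ a, ∀ z ∈ Z, (z < a → f z < f a) ∧ (a < z → f a < f z) := by
    rintro a z ⟨i, hi⟩
    exact ⟨hf.lt_of_root_lt hmono (hu i) hi, hf.lt_of_lt_root hmono (hu i) hi⟩
  have hvZ : ∀ i b, (v i).eval b = 0 → ∃ z ∈ Z, f z = b := by
    intro i b hb
    obtain ⟨a, ha, rfl⟩ := hf.exists_root hmono hg hgmono (hu i) (hv i) hb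
    exact ⟨a, ⟨i, ha⟩, rfl⟩
  let good (a : R) (b : R') : Prop :=
    (∀ z ∈ Z, (z < a → f z < b) ∧ (z = a → f z = b) ∧ (a < z → b < f z)) ∧
      SignType.sign (q.eval b) = SignType.sign (p.eval a)
  have hex : ∀ a, ∃ b, good a b := by
    intro a
    by_cases ha : a ∈ Z
    · obtain ⟨i, hi⟩ := ha
      exact ⟨f a, fun z hz ↦ ⟨(hfgap a z hz).1, fun h ↦ by rw [h], (hfgap a z hz).2⟩,
        hroot i a hi⟩
    · obtain ⟨c, hc1, hc2⟩ := exists_sign_eval_eq_in_gap hR hR' (p := p) (q := q) hZ hmono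
        (fun x hx ↦ ⟨i₀, by rwa [← hp]⟩) (fun y hy ↦ hvZ i₀ y (by rwa [← hq]))
        (fun z ⟨i, hi⟩ ↦ hroot i z hi) ha (hfgap a) (by rw [hp, hq, hf i₀ a])
      exact ⟨c, fun z hz ↦ ⟨(hc1 z hz).1, fun h ↦ absurd (h ▸ hz) ha, (hc1 z hz).2⟩, hc2⟩
  let F : R → R' := fun a ↦ Classical.epsilon (good a)
  have hF : ∀ a, good a (F a) := fun a ↦ Classical.epsilon_spec (hex a)
  have hFsign : PreservesSigns u v F := by
    intro i a
    by_cases ha : a ∈ Z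
    · rw [← ((hF a).1 a ha).2.1 rfl, hf i a]
    · rw [← hf i a]
      have hno : ∀ b, (v i).eval b = 0 → (b < f a ∧ b < F a) ∨ (f a < b ∧ F a < b) := by
        intro b hb
        obtain ⟨z, hz, rfl⟩ := hvZ i b hb
        rcases lt_trichotomy z a with h | h | h
        · exact .inl ⟨(hfgap a z hz).1 h, ((hF a).1 z hz).1 h⟩
        · exact absurd (h ▸ hz) ha
        · exact .inr ⟨(hfgap a z hz).2 h, ((hF a).1 z hz).2.2 h⟩
      rcases le_total (f a) (F a) with h | h
      · refine (hR'.sign_eval_eq _ h fun c hc1 hc2 hc ↦ ?_).symm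
        rcases hno c hc with h' | h'
        · exact h'.1.not_ge hc1
        · exact h'.2.not_ge hc2
      · refine hR'.sign_eval_eq _ h fun c hc1 hc2 hc ↦ ?_
        rcases hno c hc with h' | h'
        · exact h'.2.not_ge hc1
        · exact h'.1.not_ge hc2
  refine ⟨F, fun a a' haa' ↦ ?_, hFsign, fun a ↦ (hF a).2⟩
  rcases haa'.eq_or_lt with rfl | haa'
  · rfl
  by_cases hz : ∃ z ∈ Z, a ≤ z ∧ z ≤ a'
  · obtain ⟨z, hz, h1, h2⟩ := hz
    have h3 : F a ≤ f z := by
      rcases h1.eq_or_lt with h | h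
      · exact (((hF a).1 z hz).2.1 h.symm).ge
      · exact (((hF a).1 z hz).2.2 h).le
    have h4 : f z ≤ F a' := by
      rcases h2.eq_or_lt with h | h
      · exact (((hF a').1 z hz).2.1 h).le
      · exact (((hF a').1 z hz).1 h).le
    exact h3.trans h4
  push Not at hz
  have hside : ∀ z ∈ Z, (z < a ∧ z < a') ∨ (a < z ∧ a' < z) := by
    intro z hz'
    rcases lt_or_ge z a with h | h
    · exact .inl ⟨h, h.trans haa'⟩
    · exact .inr ⟨haa'.trans (hz z hz' h), hz z hz' h⟩
  by_cases hs : SignType.sign (p.eval a) = SignType.sign (p.eval a')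
  · have : good a = good a' := by
      ext b
      simp only [good, hs]
      refine and_congr_left fun _ ↦ forall₂_congr fun z hz ↦ ?_
      rcases hside z hz with ⟨h1, h2⟩ | ⟨h1, h2⟩
      · simp [h1, h2, h1.ne, h2.ne, h1.not_gt, h2.not_gt]
      · simp [h1, h2, h1.ne', h2.ne', h1.not_gt, h2.not_gt]
    exact (congrArg Classical.epsilon this).le
  by_contra! hlt
  have hp' : ∀ c, a ≤ c → c ≤ a' → (u i₀).eval c ≠ 0 := fun c h1 h2 hc ↦
    (hz c ⟨i₀, hc⟩ h1).not_ge h2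
  have hq' : ∀ c, F a' ≤ c → c ≤ F a → (v i₀).eval c ≠ 0 := by
    intro c h1 h2 hc
    obtain ⟨z, hz, rfl⟩ := hvZ i₀ c hc
    rcases hside z hz with ⟨-, h⟩ | ⟨h, -⟩
    · exact (((hF a').1 z hz).1 h).not_ge h1
    · exact (((hF a).1 z hz).2.2 h).not_ge h2
  have hpsign : ∀ c, a ≤ c → c ≤ a' →
      SignType.sign ((u i₀).eval a) = SignType.sign ((u i₀).eval c) := fun c h1 h2 ↦
    hR.sign_eval_eq _ h1 fun d h3 h4 ↦ hp' d h3 (h4.trans h2)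
  have hqsign : ∀ c, F a' ≤ c → c ≤ F a →
      SignType.sign ((u i₀).eval a) = SignType.sign ((v i₀).eval c) := fun c h1 h2 ↦ by
    rw [← hFsign i₀ a]
    exact (hR'.sign_eval_eq _ h2 fun d h3 h4 ↦ hq' d (h1.trans h3) h4).symm
  rcases lt_or_gt_of_ne (hp' a le_rfl haa'.le) with h | h
  · have h1 : p.eval a' < p.eval a := by
      have := hR.eval_lt_eval (-p) haa' fun c h1 h2 ↦ by
        rw [derivative_neg, hp, eval_neg, neg_pos, ← sign_eq_neg_one_iff, ← hpsign c h1.le h2.le,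
          sign_neg h]
      simpa using this
    have h2 : q.eval (F a) < q.eval (F a') := by
      have := hR'.eval_lt_eval (-q) hlt fun c h1 h2 ↦ by
        rw [derivative_neg, hq, eval_neg, neg_pos, ← sign_eq_neg_one_iff, ← hqsign c h1.le h2.le,
          sign_neg h]
      simpa using this
    have h3 := SignType.sign.monotone h1.le
    have h4 := SignType.sign.monotone h2.le
    rw [(hF a).2, (hF a').2] at h4
    exact hs (le_antisymm h4 h3)
  · have h1 : p.eval a < p.eval a' := hR.eval_lt_eval p haa' fun c h1 h2 ↦ by
      rw [hp, ← sign_eq_one_iff, ← hpsign c h1.le h2.le, sign_pos h]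
    have h2 : q.eval (F a') < q.eval (F a) := hR'.eval_lt_eval q hlt fun c h1 h2 ↦ by
      rw [hq, ← sign_eq_one_iff, ← hqsign c h1.le h2.le, sign_pos h]
    have h3 := SignType.sign.monotone h1.le
    have h4 := SignType.sign.monotone h2.le
    rw [(hF a).2, (hF a').2] at h4
    exact hs (le_antisymm h3 h4)

end Transfer

end Polynomial

namespace Polynomial

section Elimination

variable {A : Type*} [CommRing A]

theorem exists_pseudo_division (q : A[X]) {m : ℕ} (hq : q.natDegree ≤ m) (p : A[X]) :
    ∃ (k : ℕ) (s r : A[X]), C (q.coeff m ^ k) * p = q * s + r ∧ r.degree < m := by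
  obtain ⟨N, hN⟩ : ∃ N : ℕ, p.degree < N :=
    ⟨p.natDegree + 1, degree_le_natDegree.trans_lt (by exact_mod_cast Nat.lt_succ_self _)⟩
  induction N generalizing p with
  | zero => exact ⟨0, 0, p, by simp, hN.trans_le (by exact_mod_cast m.zero_le)⟩
  | succ N ih =>
    rcases lt_or_ge N m with hNm | hNm
    · exact ⟨0, 0, p, by simp, hN.trans_le (by exact_mod_cast hNm)⟩
    obtain ⟨k, s, r, h, hr⟩ := ih (C (q.coeff m) * p - C (p.coeff N) * X ^ (N - m) * q) (by
      rw [degree_lt_iff_coeff_zero] at hN ⊢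
      intro j hj
      rw [mul_assoc, coeff_sub, coeff_C_mul, coeff_C_mul, coeff_X_pow_mul', if_pos (by omega)]
      rcases hj.eq_or_lt with rfl | hj
      · rw [Nat.sub_sub_self hNm]
        ring
      · rw [hN j hj, coeff_eq_zero_of_natDegree_lt (p := q) (n := j - (N - m)) (by omega)]
        simp)
    refine ⟨k + 1, C (q.coeff m ^ k) * C (p.coeff N) * X ^ (N - m) + s, r, ?_, hr⟩
    rw [pow_succ, C_mul]
    linear_combination h

theorem map_eq_map_eraseLead {B : Type*} [CommRing B] {χ : A →+* B} {q : A[X]}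
    (hq : χ q.leadingCoeff = 0) : q.map χ = q.eraseLead.map χ := by
  conv_lhs => rw [← q.eraseLead_add_C_mul_X_pow]
  rw [Polynomial.map_add, Polynomial.map_mul, map_C, hq, C_0, zero_mul, add_zero]

variable {R R' : Type*} [Field R] [LinearOrder R] [Field R'] [LinearOrder R']

/-- There are monotone maps in both directions matching the signs of the values of the polynomials
in `s` specialized along `φ` and along `ψ`. -/
def SignsMatch (φ : A →+* R) (ψ : A →+* R') (s : Set A[X]) : Prop :=
  (∃ f : R → R', Monotone f ∧
    PreservesSigns (fun q : s ↦ q.1.map φ) (fun q ↦ q.1.map ψ) f) ∧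
  ∃ g : R' → R, Monotone g ∧
    PreservesSigns (fun q : s ↦ q.1.map ψ) (fun q ↦ q.1.map φ) g

variable {φ : A →+* R} {ψ : A →+* R'}

theorem SignsMatch.symm {s : Set A[X]} (h : SignsMatch φ ψ s) : SignsMatch ψ φ s :=
  ⟨h.2, h.1⟩

theorem SignsMatch.mono {s t : Set A[X]} (h : SignsMatch φ ψ t)
    (hst : ∀ q ∈ s, ∃ q' ∈ t, q.map φ = q'.map φ ∧ q.map ψ = q'.map ψ) : SignsMatch φ ψ s := by
  obtain ⟨⟨f, hf, hfs⟩, g, hg, hgs⟩ := h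
  refine ⟨⟨f, hf, fun ⟨q, hq⟩ a ↦ ?_⟩, g, hg, fun ⟨q, hq⟩ a ↦ ?_⟩ <;>
  · obtain ⟨q', hq', h1, h2⟩ := hst q hq
    simp only [h1, h2]
    first | exact hfs ⟨q', hq'⟩ a | exact hgs ⟨q', hq'⟩ a

variable [IsStrictOrderedRing R] [IsStrictOrderedRing R']

theorem SignsMatch.exists_monotone_insert (hR : PolynomialIVT R) (hR' : PolynomialIVT R')
    {s t : Set A[X]} (hs : s.Finite) (h : SignsMatch φ ψ (s ∪ t)) {p : A[X]}
    (hp : derivative p ∈ s) (hφ : ∀ q ∈ s, q.map φ ≠ 0) (hψ : ∀ q ∈ s, q.map ψ ≠ 0)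
    (hrem : ∀ q ∈ s, ∃ r ∈ t, ∃ (c : A) (k : ℕ) (d : A[X]), C (c ^ k) * p = q * d + r ∧
      φ c ≠ 0 ∧ SignType.sign (ψ c) = SignType.sign (φ c)) :
    ∃ f : R → R', Monotone f ∧
      PreservesSigns (fun q : (insert p s : Set A[X]) ↦ q.1.map φ) (fun q ↦ q.1.map ψ) f := by
  obtain ⟨⟨f, hf, hfs⟩, g, hg, hgs⟩ := h
  have := hs.to_subtype
  have hfs' : PreservesSigns (fun q : s ↦ q.1.map φ) (fun q ↦ q.1.map ψ) f :=
    fun q a ↦ hfs ⟨q.1, .inl q.2⟩ a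
  have hgs' : PreservesSigns (fun q : s ↦ q.1.map ψ) (fun q ↦ q.1.map φ) g :=
    fun q a ↦ hgs ⟨q.1, .inl q.2⟩ a
  obtain ⟨F, hF, hFs, hFp⟩ := PreservesSigns.exists_extension hR hR' (fun q : s ↦ hφ q.1 q.2)
    (fun q ↦ hψ q.1 q.2) hfs' hf hgs' hg (p := p.map φ) (q := p.map ψ) (i₀ := ⟨_, hp⟩)
    (derivative_map _ _) (derivative_map _ _) (by
      rintro ⟨q, hq⟩ a ha
      obtain ⟨r, hr, c, k, d, hpr, hc, hcs⟩ := hrem q hq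
      have hb := (hfs'.eval_eq_zero_iff ⟨q, hq⟩ a).2 ha
      have h1 := congrArg (fun x ↦ (x.map φ).eval a) hpr
      have h2 := congrArg (fun x ↦ (x.map ψ).eval (f a)) hpr
      dsimp only at ha hb
      simp only [Polynomial.map_mul, Polynomial.map_add, eval_mul, eval_add, map_C, eval_C, ha, hb,
        zero_mul, zero_add] at h1 h2
      have h3 : SignType.sign (φ c) ≠ 0 := by rwa [Ne, sign_eq_zero_iff]
      have h4 := hfs ⟨r, .inr hr⟩ a
      dsimp only at h4
      rw [← h1, ← h2, sign_mul, sign_mul, map_pow φ, map_pow ψ, sign_pow, sign_pow, hcs] at h4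
      exact mul_left_cancel₀ (pow_ne_zero k h3) h4)
  refine ⟨F, hF, fun ⟨q, hq⟩ a ↦ ?_⟩
  rcases hq with rfl | hq
  · exact hFp a
  · exact hFs ⟨q, hq⟩ a

theorem SignsMatch.insert_of_derivative_mem (hR : PolynomialIVT R) (hR' : PolynomialIVT R')
    {s t : Set A[X]} (hs : s.Finite) (h : SignsMatch φ ψ (s ∪ t)) {p : A[X]}
    (hp : derivative p ∈ s) (hφ : ∀ q ∈ s, q.map φ ≠ 0) (hψ : ∀ q ∈ s, q.map ψ ≠ 0)
    (hrem : ∀ q ∈ s, ∃ r ∈ t, ∃ (c : A) (k : ℕ) (d : A[X]), C (c ^ k) * p = q * d + r ∧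
      φ c ≠ 0 ∧ SignType.sign (ψ c) = SignType.sign (φ c)) :
    SignsMatch φ ψ (insert p s) := by
  refine ⟨h.exists_monotone_insert hR hR' hs hp hφ hψ hrem,
    h.symm.exists_monotone_insert hR' hR hs hp hψ hφ fun q hq ↦ ?_⟩
  obtain ⟨r, hr, c, k, d, h1, h2, h3⟩ := hrem q hq
  refine ⟨r, hr, c, k, d, h1, ?_, h3.symm⟩
  rwa [← sign_ne_zero, h3, sign_ne_zero]

/-- For a finite family of polynomials `S`, sign-matching along `φ` and `ψ` follows from the
agreement of the signs of `φ` and `ψ` on a finite set. -/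
theorem exists_finset_signsMatch (hR : PolynomialIVT R) (hR' : PolynomialIVT R') (φ : A →+* R)
    (S : Multiset A[X]) :
    ∃ T : Finset A, ∀ ψ : A →+* R', (∀ t ∈ T, SignType.sign (ψ t) = SignType.sign (φ t)) →
      SignsMatch φ ψ {q | q ∈ S} := by
  classical
  induction S using (InvImage.wf (Multiset.map degree)
    Multiset.wellFounded_isDershowitzMannaLT).induction with
  | _ S ih =>
  simp only [InvImage] at ih
  by_cases h0 : (0 : A[X]) ∈ S
  · obtain ⟨S, rfl⟩ := Multiset.exists_cons_of_mem h0
    obtain ⟨T, hT⟩ := ih S ⟨S.map degree, 0, {degree (0 : A[X])}, by simp, by simp, by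
      simp [add_comm, ← Multiset.singleton_add], by simp⟩
    refine ⟨T, fun ψ hψ ↦ ?_⟩
    obtain ⟨⟨f, hf, hfs⟩, g, hg, hgs⟩ := hT ψ hψ
    refine ⟨⟨f, hf, fun ⟨q, hq⟩ a ↦ ?_⟩, g, hg, fun ⟨q, hq⟩ a ↦ ?_⟩ <;>
    · rcases Multiset.mem_cons.1 hq with rfl | hq
      · simp
      · first | exact hfs ⟨q, hq⟩ a | exact hgs ⟨q, hq⟩ a
  by_cases hlc : ∃ q ∈ S, φ q.leadingCoeff = 0
  · obtain ⟨q, hqS, hq⟩ := hlc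
    obtain ⟨S, rfl⟩ := Multiset.exists_cons_of_mem hqS
    obtain ⟨T, hT⟩ := ih (q.eraseLead ::ₘ S) ⟨S.map degree, {degree q.eraseLead}, {degree q},
      by simp, by simp [add_comm, ← Multiset.singleton_add],
      by simp [add_comm, ← Multiset.singleton_add], by
        simpa using degree_eraseLead_lt fun h ↦ h0 (by simp [h])⟩
    refine ⟨insert q.leadingCoeff T, fun ψ hψ ↦ ?_⟩
    have hψq : ψ q.leadingCoeff = 0 := by
      rw [← sign_eq_zero_iff, hψ _ (Finset.mem_insert_self _ _), hq, sign_zero]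
    refine (hT ψ fun t ht ↦ hψ t (Finset.mem_insert_of_mem ht)).mono fun q' hq' ↦ ?_
    rcases Multiset.mem_cons.1 hq' with rfl | hq'
    · exact ⟨q'.eraseLead, by simp, map_eq_map_eraseLead hq, map_eq_map_eraseLead hψq⟩
    · exact ⟨q', by simp [hq'], rfl, rfl⟩
  push Not at hlc
  by_cases hconst : ∀ q ∈ S, q.natDegree = 0
  · refine ⟨(S.map leadingCoeff).toFinset, fun ψ hψ ↦ ?_⟩
    have hS : ∀ q ∈ S, SignType.sign (ψ (q.coeff 0)) = SignType.sign (φ (q.coeff 0)) := by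
      intro q hq
      have := hψ q.leadingCoeff (by simpa using ⟨q, hq, rfl⟩)
      rwa [leadingCoeff, hconst q hq] at this
    refine ⟨⟨fun _ ↦ 0, monotone_const, fun ⟨q, hq⟩ a ↦ ?_⟩, fun _ ↦ 0, monotone_const,
      fun ⟨q, hq⟩ a ↦ ?_⟩ <;>
    · have := hS q hq
      dsimp only
      rw [eq_C_of_natDegree_eq_zero (hconst q hq)]
      simp [this]
  push Not at hconst
  obtain ⟨p₁, hp₁, hp₁d⟩ := hconst
  obtain ⟨p, hpS, hpmax⟩ := Finset.exists_max_image S.toFinset natDegree ⟨p₁, by simpa using hp₁⟩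
  simp only [Multiset.mem_toFinset] at hpS hpmax
  have hpd : p.natDegree ≠ 0 := by have := hpmax p₁ hp₁; omega
  obtain ⟨S, rfl⟩ := Multiset.exists_cons_of_mem hpS
  have hdeg : p.degree = p.natDegree :=
    degree_eq_natDegree fun h ↦ hpd (by simp [h])
  have hdiv := fun (q : A[X]) ↦ exists_pseudo_division q le_rfl p
  choose k d r hr hrdeg using hdiv
  obtain ⟨k', d', r', hr', hr'deg⟩ := exists_pseudo_division (derivative p)
    (natDegree_derivative_le p) p
  have hS' := ih (derivative p ::ₘ r' ::ₘ (S + S.map r)) ⟨S.map degree,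
    degree (derivative p) ::ₘ degree r' ::ₘ S.map fun q ↦ degree (r q), {degree p},
    by simp, by
      simp only [Multiset.map_cons, Multiset.map_add, Multiset.map_map, Function.comp_def]
      simp only [← Multiset.singleton_add]
      abel, by simp [add_comm, ← Multiset.singleton_add], by
      simp only [Multiset.mem_cons, Multiset.mem_map, Multiset.mem_singleton, exists_eq_left]
      rintro y (rfl | rfl | ⟨q, hq, rfl⟩)
      · exact degree_derivative_lt fun h ↦ hpd (by simp [h])
      · rw [hdeg]
        exact hr'deg.trans_le (by exact_mod_cast Nat.sub_le _ _)
      · rw [hdeg]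
        exact (hrdeg q).trans_le (by exact_mod_cast hpmax q (by simp [hq]))⟩
  obtain ⟨T, hT⟩ := hS'
  have hφc : φ ((derivative p).coeff (p.natDegree - 1)) ≠ 0 := by
    rw [coeff_derivative, Nat.sub_add_cancel (by omega)]
    have h1 := hlc p hpS
    have h2 : ((p.natDegree - 1 : ℕ) + 1 : R) ≠ 0 := by positivity
    simpa using ⟨h1, h2⟩
  refine ⟨insert ((derivative p).coeff (p.natDegree - 1)) (T ∪ (S.map leadingCoeff).toFinset),
    fun ψ hψ ↦ ?_⟩
  have hψc := hψ _ (Finset.mem_insert_self _ _)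
  have hψS : ∀ q ∈ S, SignType.sign (ψ q.leadingCoeff) = SignType.sign (φ q.leadingCoeff) :=
    fun q hq ↦ hψ _ (by simp only [Finset.mem_insert, Finset.mem_union, Multiset.mem_toFinset,
      Multiset.mem_map]; exact .inr (.inr ⟨q, hq, rfl⟩))
  have hmatch := hT ψ fun t ht ↦ hψ t (by simp [ht])
  have hne : ∀ q ∈ insert (derivative p) {q | q ∈ S}, ∃ j, φ (q.coeff j) ≠ 0 ∧
      SignType.sign (ψ (q.coeff j)) = SignType.sign (φ (q.coeff j)) := by
    rintro q (rfl | hq)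
    · exact ⟨_, hφc, hψc⟩
    · exact ⟨_, hlc q (by simp [show q ∈ S from hq]), hψS q hq⟩
  have := SignsMatch.insert_of_derivative_mem (φ := φ) (ψ := ψ) hR hR'
    (s := insert (derivative p) {q | q ∈ S}) (t := insert r' (r '' {q | q ∈ S})) (p := p)
    ((S.finite_toSet).insert _) (hmatch.mono fun q hq ↦ ⟨q, by
      simp at hq ⊢
      tauto, rfl, rfl⟩) (.inl rfl)
    (fun q hq h ↦ by
      obtain ⟨j, hj, -⟩ := hne q hq
      exact hj (by rw [← coeff_map, h, coeff_zero]))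
    (fun q hq h ↦ by
      obtain ⟨j, hj, hj'⟩ := hne q hq
      rw [← sign_ne_zero, ← hj', ← coeff_map, h, coeff_zero, sign_zero] at hj
      exact hj rfl)
    (by
      rintro q (rfl | hq)
      · exact ⟨r', .inl rfl, _, k', d', hr', hφc, hψc⟩
      · exact ⟨r q, .inr ⟨q, hq, rfl⟩, _, k q, d q, hr q, hlc q (by simp [show q ∈ S from hq]),
          hψS q hq⟩)
  refine this.mono fun q hq ↦ ⟨q, ?_, rfl, rfl⟩
  simp at hq ⊢
  tauto

end Elimination

end Polynomial

theorem polynomialIVT_real : PolynomialIVT ℝ := by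
  intro p a b hab h
  have hcont : ContinuousOn (fun x ↦ p.eval x) (Set.Icc a b) := p.continuous.continuousOn
  have hroot : ∃ c ∈ Set.Icc a b, p.eval c = 0 := by
    rcases mul_neg_iff.1 h with ⟨ha, hb⟩ | ⟨ha, hb⟩
    · exact intermediate_value_Icc' hab.le hcont ⟨hb.le, ha.le⟩
    · exact intermediate_value_Icc hab.le hcont ⟨ha.le, hb.le⟩
  obtain ⟨c, ⟨hac, hcb⟩, hc⟩ := hroot
  refine ⟨c, lt_of_le_of_ne hac ?_, lt_of_le_of_ne hcb ?_, hc⟩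
  · rintro rfl
    simp [hc] at h
  · rintro rfl
    simp [hc] at h

section RealPoint

variable {R : Type*} [Field R] [LinearOrder R] [IsStrictOrderedRing R]

theorem sign_map_real (φ : ℝ →+* R) (x : ℝ) : SignType.sign (φ x) = SignType.sign x := by
  have hpos : ∀ y : ℝ, 0 < y → 0 < φ y := by
    intro y hy
    rw [← Real.mul_self_sqrt hy.le, map_mul, ← pow_two]
    exact sq_pos_of_ne_zero ((map_ne_zero φ).2 (Real.sqrt_pos.2 hy).ne')
  rcases lt_trichotomy x 0 with hx | rfl | hx
  · rw [sign_neg hx, sign_neg]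
    simpa using hpos (-x) (neg_pos.2 hx)
  · simp
  · rw [sign_pos hx, sign_pos (hpos x hx)]

/-- Every sign condition satisfied at a point of an ordered field with the intermediate value
property for polynomials is satisfied at a real point. -/
theorem exists_real_point_sign_eq (hR : PolynomialIVT R) (n : ℕ)
    (φ : MvPolynomial (Fin n) ℝ →+* R) (S : Finset (MvPolynomial (Fin n) ℝ)) :
    ∃ z : Fin n → ℝ, ∀ s ∈ S, SignType.sign (eval z s) = SignType.sign (φ s) := by
  induction n with
  | zero =>
    refine ⟨Fin.elim0, fun s _ ↦ ?_⟩
    rw [eq_C_of_isEmpty s, eval_C, ← sign_map_real (φ.comp C)]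
    rfl
  | succ n ih =>
    let e := finSuccEquiv ℝ n
    let φ' : MvPolynomial (Fin n) ℝ →+* R :=
      φ.comp ((e.symm : _ →+* _).comp Polynomial.C)
    have hφ : ∀ s, φ s = ((e s).map φ').eval (φ (e.symm Polynomial.X)) := by
      intro s
      have : φ.comp (e.symm : _ →+* _) = Polynomial.eval₂RingHom φ' (φ (e.symm Polynomial.X)) := by
        ext <;> simp [φ']
      rw [Polynomial.eval_map, ← Polynomial.coe_eval₂RingHom, ← this]
      simp
    obtain ⟨T, hT⟩ := Polynomial.exists_finset_signsMatch hR polynomialIVT_real φ' (S.val.map e)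
    obtain ⟨z, hz⟩ := ih φ' T
    obtain ⟨⟨f, -, hf⟩, -⟩ := hT (eval z) hz
    refine ⟨Fin.cons (f (φ (e.symm Polynomial.X))) z, fun s hs ↦ ?_⟩
    rw [eval_eq_eval_mv_eval', hφ s]
    exact hf ⟨e s, Multiset.mem_map_of_mem _ hs⟩ _

end RealPoint

theorem IsSumSq.isSOS {n : ℕ} {p : MvPolynomial (Fin n) ℝ} (hp : IsSumSq p) : IsSOS p := by
  induction hp with
  | zero => exact ⟨0, Fin.elim0, by simp⟩
  | sq_add a _ ih =>
    obtain ⟨m, q, rfl⟩ := ih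
    exact ⟨m + 1, Fin.cons a q, by simp [Fin.sum_univ_succ, pow_two]⟩

theorem IsSOS.eval_nonneg {n : ℕ} {p : MvPolynomial (Fin n) ℝ} (hp : IsSOS p) (z : Fin n → ℝ) :
    0 ≤ eval z p := by
  obtain ⟨m, q, rfl⟩ := hp
  simp only [map_sum, map_pow]
  positivity

section ConePlusIdeal

variable {A : Type*} [CommRing A] {s w : ℕ} {f : Fin s → A} {h : Fin w → A}

/-- The sum of the positive cone generated by `f` and the ideal generated by `h`. -/
def conePlusIdeal (f : Fin s → A) (h : Fin w → A) : Set A :=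
  {x | ∃ (σ : (Fin s → Bool) → A) (lam : Fin w → A), (∀ α, IsSumSq (σ α)) ∧
    x = ∑ α, σ α * ∏ j, f j ^ (α j).toNat + ∑ l, lam l * h l}

theorem conePlusIdeal.add_mem {x y : A} (hx : x ∈ conePlusIdeal f h)
    (hy : y ∈ conePlusIdeal f h) : x + y ∈ conePlusIdeal f h := by
  obtain ⟨σ, lam, hσ, rfl⟩ := hx
  obtain ⟨σ', lam', hσ', rfl⟩ := hy
  refine ⟨σ + σ', lam + lam', fun α ↦ (hσ α).add (hσ' α), ?_⟩
  simp only [Pi.add_apply, add_mul, Finset.sum_add_distrib]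
  ring

theorem conePlusIdeal.sumSq_mem {x : A} (hx : IsSumSq x) : x ∈ conePlusIdeal f h := by
  refine ⟨Pi.single (fun _ ↦ false) x, 0, fun α ↦ ?_, ?_⟩
  · rw [Pi.single_apply]
    split_ifs
    · exact hx
    · exact .zero
  · rw [Fintype.sum_eq_single (fun _ ↦ false) fun α hα ↦ by simp [hα]]
    simp

theorem conePlusIdeal.ideal_mem (lam : Fin w → A) : ∑ l, lam l * h l ∈ conePlusIdeal f h :=
  ⟨0, lam, fun _ ↦ .zero, by simp⟩

theorem conePlusIdeal.sumSq_mul_mem {x y : A} (hx : IsSumSq x) (hy : y ∈ conePlusIdeal f h) :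
    x * y ∈ conePlusIdeal f h := by
  obtain ⟨σ, lam, hσ, rfl⟩ := hy
  refine ⟨fun α ↦ x * σ α, fun l ↦ x * lam l, fun α ↦ hx.mul (hσ α), ?_⟩
  simp only [mul_add, Finset.mul_sum, mul_assoc]

theorem conePlusIdeal.generator_mul_mem (i : Fin s) {x : A} (hx : x ∈ conePlusIdeal f h) :
    f i * x ∈ conePlusIdeal f h := by
  obtain ⟨σ, lam, hσ, rfl⟩ := hx
  let e : (Fin s → Bool) → Fin s → Bool := fun α ↦ Function.update α i (!α i)
  have he : Function.Involutive e := fun α ↦ by simp [e]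
  refine ⟨fun α ↦ σ (e α) * if α i then 1 else f i * f i, fun l ↦ f i * lam l, fun α ↦ ?_, ?_⟩
  · refine (hσ _).mul ?_
    split_ifs
    exacts [.one, .mul_self _]
  rw [mul_add, Finset.mul_sum, Finset.mul_sum, ← Equiv.sum_comp he.toPerm (fun α ↦
    σ (e α) * (if α i then 1 else f i * f i) * ∏ j, f j ^ (α j).toNat)]
  congr 1
  · refine Finset.sum_congr rfl fun α _ ↦ ?_
    have h1 : ∏ j ∈ Finset.univ.erase i, f j ^ (e α j).toNat =
        ∏ j ∈ Finset.univ.erase i, f j ^ (α j).toNat :=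
      Finset.prod_congr rfl fun j hj ↦ by simp [e, Finset.ne_of_mem_erase hj]
    simp only [Function.Involutive.coe_toPerm, he α]
    rw [← Finset.mul_prod_erase _ (fun j ↦ f j ^ (e α j).toNat) (Finset.mem_univ i),
      ← Finset.mul_prod_erase _ (fun j ↦ f j ^ (α j).toNat) (Finset.mem_univ i), h1]
    cases hα : α i
    · simp [e, hα]
      ring
    · simp [e, hα]
      ring
  · exact Finset.sum_congr rfl fun l _ ↦ by ring

theorem conePlusIdeal.isSquareCone (f : Fin s → A) (h : Fin w → A) :
    IsSquareCone (conePlusIdeal f h) where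
  add_mem := conePlusIdeal.add_mem
  sq_mem x := conePlusIdeal.sumSq_mem (pow_two x ▸ .mul_self x)
  mul_mem := by
    intro x y hx hy
    have hprod (α : Fin s → Bool) (t : Finset (Fin s)) :
        (∏ j ∈ t, f j ^ (α j).toNat) * y ∈ conePlusIdeal f h := by
      induction t using Finset.cons_induction with
      | empty => simpa
      | cons j t hj ih =>
        rw [Finset.prod_cons, mul_assoc]
        cases α j
        · simpa using ih
        · simpa using conePlusIdeal.generator_mul_mem j ih
    obtain ⟨σ, lam, hσ, rfl⟩ := hx
    rw [add_mul, Finset.sum_mul, Finset.sum_mul]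
    refine conePlusIdeal.add_mem (Finset.sum_induction _ (· ∈ conePlusIdeal f h)
      (fun _ _ ↦ conePlusIdeal.add_mem) (conePlusIdeal.sumSq_mem .zero) fun α _ ↦ ?_) ?_
    · rw [mul_assoc]
      exact conePlusIdeal.sumSq_mul_mem (hσ α) (hprod α _)
    · simp only [mul_right_comm]
      exact conePlusIdeal.ideal_mem fun l ↦ lam l * y

theorem conePlusIdeal.generator_mem (i : Fin s) : f i ∈ conePlusIdeal f h := by
  simpa using conePlusIdeal.generator_mul_mem i (conePlusIdeal.sumSq_mem (h := h) .one)

theorem conePlusIdeal.mul_relation_mem (a : A) (l : Fin w) : a * h l ∈ conePlusIdeal f h := by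
  simpa [Pi.single_apply] using conePlusIdeal.ideal_mem (f := f) (h := h) (Pi.single l a)

end ConePlusIdeal

/-- Stengle's Positivstellensatz. -/
theorem stengle_positivstellensatz (n s t w : ℕ)
    (f : Fin s → MvPolynomial (Fin n) ℝ)
    (g : Fin t → MvPolynomial (Fin n) ℝ)
    (h : Fin w → MvPolynomial (Fin n) ℝ) :
    {z : Fin n → ℝ | (∀ j, 0 ≤ eval z (f j)) ∧ (∀ k, eval z (g k) ≠ 0) ∧
      (∀ l, eval z (h l) = 0)} = ∅ ↔
    ∃ (σ : (Fin s → Bool) → MvPolynomial (Fin n) ℝ) (β : Fin t → ℕ)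
      (lam : Fin w → MvPolynomial (Fin n) ℝ),
      (∀ α, IsSOS (σ α)) ∧
      (∑ α : Fin s → Bool, σ α * ∏ j, (f j) ^ (α j).toNat) +
        (∏ k, (g k) ^ (β k)) ^ 2 + (∑ l, lam l * h l) = 0 := by
  constructor
  · intro hempty
    by_contra hcert
    let M : Submonoid (MvPolynomial (Fin n) ℝ) :=
      { carrier := {x | ∃ β : Fin t → ℕ, x = ∏ k, g k ^ β k}
        one_mem' := ⟨0, by simp⟩
        mul_mem' := by
          rintro _ _ ⟨β, rfl⟩ ⟨β', rfl⟩
          exact ⟨β + β', by simp [pow_add, Finset.prod_mul_distrib]⟩ }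
    have hgM (k : Fin t) : g k ∈ M := by
      refine ⟨Pi.single k 1, ?_⟩
      rw [Fintype.prod_eq_single k fun j hj ↦ by simp [hj]]
      simp
    obtain ⟨P, hP, hQP, hMP, htot, hprime⟩ :=
      (conePlusIdeal.isSquareCone f h).exists_prime_extension M (by
        rintro _ ⟨β, rfl⟩ ⟨σ, lam, hσ, hm⟩
        refine hcert ⟨σ, β, lam, fun α ↦ (hσ α).isSOS, ?_⟩
        linear_combination -hm)
    obtain ⟨R, _, _, _, φ, hR, hφP, hφ0⟩ := exists_ringHom_polynomialIVT hP
      (by simpa using hMP 1 M.one_mem) htot hprime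
    classical
    obtain ⟨z, hz⟩ := exists_real_point_sign_eq hR n φ
      (Finset.univ.image f ∪ Finset.univ.image g ∪ Finset.univ.image h)
    refine Set.notMem_empty z (hempty ▸ ⟨fun j ↦ ?_, fun k ↦ ?_, fun l ↦ ?_⟩)
    · rw [← sign_nonneg_iff, hz _ (by simp), sign_nonneg_iff]
      exact hφP _ (hQP (conePlusIdeal.generator_mem j))
    · rw [← sign_ne_zero, hz _ (by simp), sign_ne_zero]
      intro hk
      have := hP.mul_mem (hφ0 _ hk).1 (hφ0 _ hk).2
      exact hMP _ (hgM k) (by rwa [pow_two, ← mul_neg])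
    · rw [← sign_eq_zero_iff, hz _ (by simp), sign_eq_zero_iff]
      have h1 := hφP _ (hQP (conePlusIdeal.mul_relation_mem 1 l))
      have h2 := hφP _ (hQP (conePlusIdeal.mul_relation_mem (-1) l))
      simp only [map_mul, map_neg, map_one] at h1 h2
      linarith
  · rintro ⟨σ, β, lam, hσ, hcert⟩
    refine Set.eq_empty_of_forall_notMem fun z ⟨hf, hg, hh⟩ ↦ ?_
    have h0 := congrArg (eval z) hcert
    simp only [map_add, map_sum, map_mul, map_prod, map_pow, hh, mul_zero, Finset.sum_const_zero,
      add_zero, map_zero] at h0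
    have h1 : 0 ≤ ∑ α, eval z (σ α) * ∏ j, eval z (f j) ^ (α j).toNat :=
      Finset.sum_nonneg fun α _ ↦ mul_nonneg ((hσ α).eval_nonneg z)
        (Finset.prod_nonneg fun j _ ↦ pow_nonneg (hf j) _)
    have h2 : 0 < (∏ k, eval z (g k) ^ β k) ^ 2 :=
      sq_pos_of_ne_zero (Finset.prod_ne_zero_iff.2 fun k _ ↦ pow_ne_zero _ (hg k))
    linarith
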